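/- Let n ≥ 1, let k > ℓ ≥ 1 be integers, let s ≥ 1 be an integer, and let e be a positive divisor of both s and n. Let ψ : ZMod n → ZMod e be the canonical ring projection, whose kernel is the cyclic subgroup of ZMod n generated by e. Suppose A ⊆ ZMod n is {0,s}-(k,ℓ)-sum-free (with {0,s} the image of {0, s} ⊆ ℤ in ZMod n) and that the cyclic subgroup generated by e is contained in stab(k *_{{0,s}} A). Then the image ψ(A) ⊆ ZMod e is (k,ℓ)-sum-free, i.e., k·ψ(A) ∩ ℓ·ψ(A) = ∅; consequently |A| ≤ μ_{k,ℓ}(ZMod e) · (n/e). -/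

import Mathlib

open Finset Pointwise

/-- The `k`-fold Minkowski sum `kA = A + ⋯ + A` (with `0A = {0}`). -/
def iterSum {n : ℕ} : ℕ → Finset (ZMod n) → Finset (ZMod n)
  | 0, _ => {0}
  | j + 1, A => A + iterSum j A

/-- The noisy `k`-fold sum `k *_C A = kA + (k-1)C`. -/
def noisy {n : ℕ} (C : Finset (ZMod n)) (k : ℕ) (A : Finset (ZMod n)) :
    Finset (ZMod n) :=
  iterSum k A + iterSum (k - 1) C

/-- `A` is `C`-`(k,ℓ)`-sum-free: `(k *_C A) ∩ (ℓ *_C A) = ∅`. -/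
def SumFree {n : ℕ} (C : Finset (ZMod n)) (k l : ℕ) (A : Finset (ZMod n)) : Prop :=
  noisy C k A ∩ noisy C l A = ∅

/-- `μ^C_{k,ℓ}(ZMod n)`: the maximum size of a `C`-`(k,ℓ)`-sum-free subset of `ZMod n`. -/
noncomputable def mu (n : ℕ) (k l : ℕ) (C : Finset (ZMod n)) : ℕ :=
  sSup {m | ∃ A : Finset (ZMod n), SumFree C k l A ∧ A.card = m}

/-- The stabilizer `stab(X) = {g : g + X = X}` of a finite subset of `ZMod n`. -/
def stab {n : ℕ} (X : Finset (ZMod n)) : Set (ZMod n) :=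
  {g | X.image (g + ·) = X}

theorem iterSum_image {n m : ℕ} (f : ZMod n →+* ZMod m) (j : ℕ) (A : Finset (ZMod n)) :
    iterSum j (A.image f) = (iterSum j A).image f := by
  induction j with
  | zero => simp [iterSum]
  | succ j ih => simp only [iterSum, ih, Finset.image_add f]

theorem zero_mem_iterSum {n : ℕ} {C : Finset (ZMod n)} (hC : 0 ∈ C) (j : ℕ) :
    0 ∈ iterSum j C := by
  induction j with
  | zero => simp [iterSum]
  | succ j ih => simpa [iterSum] using Finset.add_mem_add hC ih

theorem iterSum_singleton_zero {n : ℕ} (j : ℕ) :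
    iterSum j ({0} : Finset (ZMod n)) = {0} := by
  induction j with
  | zero => rfl
  | succ j ih => simp [iterSum, ih]

theorem iterSum_subset_noisy {n : ℕ} {C : Finset (ZMod n)} (hC : 0 ∈ C) (k : ℕ)
    (A : Finset (ZMod n)) : iterSum k A ⊆ noisy C k A := fun x hx => by
  simpa [noisy] using Finset.add_mem_add hx (zero_mem_iterSum hC (k - 1))

theorem sumFree_singleton_zero_iff {n k l : ℕ} {A : Finset (ZMod n)} :
    SumFree {0} k l A ↔ iterSum k A ∩ iterSum l A = ∅ := by
  rw [SumFree, noisy, noisy, iterSum_singleton_zero, iterSum_singleton_zero,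
    Finset.singleton_zero, add_zero, add_zero]

theorem SumFree.card_le_mu {n k l : ℕ} [NeZero n] {C A : Finset (ZMod n)}
    (h : SumFree C k l A) : A.card ≤ mu n k l C := by
  refine le_csSup ⟨Fintype.card (ZMod n), ?_⟩ ⟨A, h, rfl⟩
  rintro _ ⟨B, -, rfl⟩
  exact B.card_le_univ

theorem sub_mem_zmultiples_of_castHom_eq {n e : ℕ} [NeZero n] (hen : e ∣ n) {x y : ZMod n}
    (h : ZMod.castHom hen (ZMod e) x = ZMod.castHom hen (ZMod e) y) :
    x - y ∈ AddSubgroup.zmultiples (e : ZMod n) := by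
  have h0 : ZMod.castHom hen (ZMod e) (x - y) = 0 := by rw [map_sub, h, sub_self]
  rw [← ZMod.natCast_zmod_val (x - y), map_natCast, ZMod.natCast_eq_zero_iff] at h0
  obtain ⟨c, hc⟩ := h0
  refine AddSubgroup.mem_zmultiples_iff.2 ⟨c, ?_⟩
  rw [← ZMod.natCast_zmod_val (x - y), hc]
  push_cast
  simp [mul_comm]

theorem card_le_card_image_castHom_mul {n e : ℕ} [NeZero n] (hen : e ∣ n)
    (A : Finset (ZMod n)) :
    A.card ≤ (A.image (ZMod.castHom hen (ZMod e))).card * (n / e) := by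
  classical
  rw [mul_comm]
  refine Finset.card_le_mul_card_image A _ fun b hb => ?_
  obtain ⟨a, -, rfl⟩ := Finset.mem_image.1 hb
  have hcard : Nat.card (AddSubgroup.zmultiples (e : ZMod n)) = n / e := by
    rw [Nat.card_zmultiples, ZMod.addOrderOf_coe e (NeZero.ne n), Nat.gcd_eq_right hen]
  rw [← hcard, ← SetLike.coe_sort_coe, Nat.card_coe_set_eq, ← Set.ncard_coe_finset]
  refine Set.ncard_le_ncard_of_injOn (· - a) (fun x hx => ?_)
    (fun x _ y _ hxy => sub_left_injective hxy) (Set.toFinite _)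
  exact sub_mem_zmultiples_of_castHom_eq hen (Finset.mem_filter.1 hx).2

theorem stmt18 (n : ℕ) [NeZero n] (k l s e : ℕ) (hl : 1 ≤ l) (hkl : l < k) (hs : 1 ≤ s)
    (he : 0 < e) (hes : e ∣ s) (hen : e ∣ n)
    (A : Finset (ZMod n))
    (hfree : SumFree ({0, (s : ZMod n)} : Finset (ZMod n)) k l A)
    (hstab : (AddSubgroup.zmultiples ((e : ZMod n)) : Set (ZMod n)) ⊆
        stab (noisy ({0, (s : ZMod n)} : Finset (ZMod n)) k A)) :
    iterSum k (A.image (ZMod.castHom hen (ZMod e)))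
        ∩ iterSum l (A.image (ZMod.castHom hen (ZMod e))) = ∅ ∧
      A.card ≤ mu e k l ({0} : Finset (ZMod e)) * (n / e) := by
  have : NeZero e := ⟨he.ne'⟩
  have hC : (0 : ZMod n) ∈ ({0, (s : ZMod n)} : Finset (ZMod n)) := Finset.mem_insert_self _ _
  have himage : iterSum k (A.image (ZMod.castHom hen (ZMod e)))
      ∩ iterSum l (A.image (ZMod.castHom hen (ZMod e))) = ∅ := by
    rw [iterSum_image, iterSum_image, ← Finset.disjoint_iff_inter_eq_empty,
      Finset.disjoint_left]
    intro z hzk hzl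
    obtain ⟨x, hx, rfl⟩ := Finset.mem_image.1 hzk
    obtain ⟨y, hy, hyx⟩ := Finset.mem_image.1 hzl
    have hfix : (noisy {0, (s : ZMod n)} k A).image (y - x + ·) = noisy {0, (s : ZMod n)} k A :=
      hstab (sub_mem_zmultiples_of_castHom_eq hen hyx)
    have hyk : y ∈ noisy {0, (s : ZMod n)} k A := by
      rw [← hfix]
      exact Finset.mem_image.2 ⟨x, iterSum_subset_noisy hC k A hx, sub_add_cancel y x⟩
    exact Finset.disjoint_left.1 (Finset.disjoint_iff_inter_eq_empty.2 hfree) hyk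
      (iterSum_subset_noisy hC l A hy)
  exact ⟨himage, (card_le_card_image_castHom_mul hen A).trans
    (Nat.mul_le_mul_right _ (sumFree_singleton_zero_iff.2 himage).card_le_mu)⟩
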